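/- arXiv:1304.6589 — 3 statements merged into one kernel-verified Lean document; each statement's English description precedes it below -/
import Mathlib

section
/- Let N ≥ 2 be an integer, ζ := exp(2πi/N) ∈ ℂ, and let ω be a normalized homogeneous weight on ℤ_N = ℤ/Nℤ. For a ∈ ℤ_N and x ∈ ℤ_N write ζ^{a·x} for ζ raised to any integer representative of the product a·x (well-defined since ζ^N = 1). Define the relation ~₁ on ℤ_N by: a ~₁ b iff for every c ∈ ℝ, Σ_{x ∈ ℤ_N, ω(x)=c} ζ^{a·x} = Σ_{x ∈ ℤ_N, ω(x)=c} ζ^{b·x}; and define ~₂ by: a ~₂ b iff for every equivalence class Q of ~₁, Σ_{x ∈ Q} ζ^{a·x} = Σ_{x ∈ Q} ζ^{b·x}. Then the relation ~₂ coincides with the relation 'ω(a) = ω(b)' (i.e., the homogeneous weight partition of ℤ_N is reflexive) if and only if N is separating. -/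
open scoped Classical

/-- `ω : R → ℝ` is a normalized homogeneous weight on the finite ring `R`. -/
def IsNormHomWeight (R : Type*) [Ring R] [Fintype R] [DecidableEq R] (ω : R → ℝ) : Prop :=
  ω 0 = 0 ∧
  (∀ x y : R, Finset.image (fun r => r * x) Finset.univ
      = Finset.image (fun r => r * y) Finset.univ → ω x = ω y) ∧
  ∀ x : R, x ≠ 0 →
    ∑ y ∈ Finset.image (fun r => r * x) Finset.univ, ω y
      = ((Finset.image (fun r => r * x) Finset.univ).card : ℝ)

/-- `N` is separating: the list of its distinct prime factors, each with multiplicity `1`,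
is separating.  (Tuples in `{0,1}^t` are encoded as subsets of the prime factors.) -/
def SeparatingNat (N : ℕ) : Prop :=
  ∀ S T : Finset ℕ, S ⊆ N.primeFactors → T ⊆ N.primeFactors → S ≠ T →
    (∏ p ∈ S, (p - 1)) ≠ (∏ p ∈ T, (p - 1)) ∨ S.card % 2 ≠ T.card % 2

/-- `a ~₁ b`: for every `c ∈ ℝ`, the sums of `ζ^{a·x}` and `ζ^{b·x}` over the level set
`{x : ω x = c}` agree (the dual relation of the homogeneous weight partition). -/
def HomRel1 (N : ℕ) [NeZero N] (ζ : ℂ) (ω : ZMod N → ℝ) (a b : ZMod N) : Prop :=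
  ∀ c : ℝ,
    ∑ x ∈ Finset.univ.filter (fun x : ZMod N => ω x = c), ζ ^ (a * x).val
      = ∑ x ∈ Finset.univ.filter (fun x : ZMod N => ω x = c), ζ ^ (b * x).val

/-- `a ~₂ b`: for every equivalence class `Q` of `~₁`, the sums of `ζ^{a·x}` and `ζ^{b·x}`
over `Q` agree (the bidual relation of the homogeneous weight partition). -/
def HomRel2 (N : ℕ) [NeZero N] (ζ : ℂ) (ω : ZMod N → ℝ) (a b : ZMod N) : Prop :=
  ∀ a₀ : ZMod N,
    ∑ x ∈ Finset.univ.filter (fun x : ZMod N => HomRel1 N ζ ω a₀ x), ζ ^ (a * x).val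
      = ∑ x ∈ Finset.univ.filter (fun x : ZMod N => HomRel1 N ζ ω a₀ x), ζ ^ (b * x).val

open ArithmeticFunction (moebius)

section UnitsAndOrders

variable {N : ℕ}

lemma ZMod.addOrderOf_isUnit_mul {u : ZMod N} (hu : IsUnit u) (x : ZMod N) :
    addOrderOf (u * x) = addOrderOf x := by
  refine addOrderOf_eq_addOrderOf_iff.2 fun n => ?_
  rw [nsmul_eq_mul, nsmul_eq_mul, mul_left_comm, hu.mul_right_eq_zero]

lemma ZMod.addOrderOf_unit_mul (u : (ZMod N)ˣ) (x : ZMod N) :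
    addOrderOf (u * x) = addOrderOf x :=
  ZMod.addOrderOf_isUnit_mul u.isUnit x

lemma ZMod.addOrderOf_dvd (x : ZMod N) : addOrderOf x ∣ N := by
  rw [addOrderOf_dvd_iff_nsmul_eq_zero]; simp

lemma ZMod.addOrderOf_dvd_iff_natCast_mul {n : ℕ} {x : ZMod N} :
    addOrderOf x ∣ n ↔ (n : ZMod N) * x = 0 := by
  rw [addOrderOf_dvd_iff_nsmul_eq_zero, nsmul_eq_mul]

lemma ZMod.addOrderOf_add_dvd_iff {n : ℕ} {t x : ZMod N} (ht : addOrderOf t ∣ n) :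
    addOrderOf (t + x) ∣ n ↔ addOrderOf x ∣ n := by
  simp only [ZMod.addOrderOf_dvd_iff_natCast_mul] at ht ⊢
  rw [mul_add, ht, zero_add]

variable [NeZero N]

lemma ZMod.mul_eq_zero_iff_addOrderOf_dvd_val {a x : ZMod N} :
    a * x = 0 ↔ addOrderOf x ∣ a.val := by
  rw [ZMod.addOrderOf_dvd_iff_natCast_mul, ZMod.natCast_zmod_val]

lemma ZMod.dvd_val_iff_castHom_eq_zero {d : ℕ} (h : d ∣ N) (a : ZMod N) :
    d ∣ a.val ↔ ZMod.castHom h (ZMod d) a = 0 := by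
  rw [ZMod.castHom_apply, ← ZMod.natCast_val, ZMod.natCast_eq_zero_iff]

lemma ZMod.dvd_val_unit_mul_iff {d : ℕ} (h : d ∣ N) {u : ZMod N} (hu : IsUnit u) (m : ℕ) :
    d ∣ (u * (m : ZMod N)).val ↔ d ∣ m := by
  rw [ZMod.dvd_val_iff_castHom_eq_zero h, map_mul, (hu.map (ZMod.castHom h (ZMod d))).mul_right_eq_zero,
    map_natCast, ZMod.natCast_eq_zero_iff]

lemma ZMod.dvd_val_natCast_add_iff {d m : ℕ} (h : d ∣ N) (hdm : d ∣ m) {x : ZMod N} :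
    d ∣ ((m : ZMod N) + x).val ↔ d ∣ x.val := by
  rw [ZMod.dvd_val_iff_castHom_eq_zero h, ZMod.dvd_val_iff_castHom_eq_zero h, map_add, map_natCast,
    (ZMod.natCast_eq_zero_iff m d).2 hdm, zero_add]

lemma ZMod.addOrderOf_natCast_of_dvd {d : ℕ} (h : d ∣ N) :
    addOrderOf (d : ZMod N) = N / d := by
  rw [ZMod.addOrderOf_coe d (NeZero.ne N), Nat.gcd_eq_right h]

lemma ZMod.addOrderOf_dvd_addOrderOf_iff {x y : ZMod N} :
    addOrderOf y ∣ addOrderOf x ↔ ∃ r, r * x = y := by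
  constructor
  · obtain ⟨d, hd, u, hu, rfl⟩ := ZMod.eq_unit_mul_divisor x
    obtain ⟨e, he, v, hv, rfl⟩ := ZMod.eq_unit_mul_divisor y
    rw [ZMod.addOrderOf_isUnit_mul hu, ZMod.addOrderOf_isUnit_mul hv,
      ZMod.addOrderOf_natCast_of_dvd hd, ZMod.addOrderOf_natCast_of_dvd he]
    intro h
    obtain ⟨k, rfl⟩ : d ∣ e := by
      simpa only [Nat.div_div_self hd (NeZero.ne N), Nat.div_div_self he (NeZero.ne N)] using
        Nat.div_dvd_div_left (Nat.div_dvd_of_dvd hd) h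
    obtain ⟨u, rfl⟩ := hu
    refine ⟨v * k * (u⁻¹ : (ZMod N)ˣ), ?_⟩
    rw [mul_assoc, Units.inv_mul_cancel_left]
    push_cast; ring
  · rintro ⟨r, rfl⟩
    rw [ZMod.addOrderOf_dvd_iff_natCast_mul, mul_left_comm]
    have : ((addOrderOf x : ℕ) : ZMod N) * x = 0 := by
      rw [← ZMod.addOrderOf_dvd_iff_natCast_mul]
    rw [this, mul_zero]

lemma ZMod.exists_unit_mul_of_addOrderOf_eq {a b : ZMod N} (h : addOrderOf a = addOrderOf b) :
    ∃ u : (ZMod N)ˣ, b = u * a := by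
  obtain ⟨d, hd, u, hu, rfl⟩ := ZMod.eq_unit_mul_divisor a
  obtain ⟨e, he, v, hv, rfl⟩ := ZMod.eq_unit_mul_divisor b
  rw [ZMod.addOrderOf_isUnit_mul hu, ZMod.addOrderOf_isUnit_mul hv,
      ZMod.addOrderOf_natCast_of_dvd hd, ZMod.addOrderOf_natCast_of_dvd he] at h
  have hde : d = e := (Nat.div_eq_iff_eq_of_dvd_dvd (NeZero.ne N) hd he).1 h
  subst hde
  obtain ⟨u, rfl⟩ := hu
  obtain ⟨v, rfl⟩ := hv
  exact ⟨v * u⁻¹, by rw [Units.val_mul, mul_assoc, Units.inv_mul_cancel_left]⟩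

lemma Nat.dvd_of_squarefree_of_forall_prime {m n : ℕ} (hm : Squarefree m)
    (h : ∀ p, p.Prime → p ∣ m → p ∣ n) : m ∣ n := by
  rw [← Nat.prod_primeFactors_of_squarefree hm]
  exact Finset.prod_primes_dvd n (fun p hp => (Nat.prime_of_mem_primeFactors hp).prime)
    fun p hp => h p (Nat.prime_of_mem_primeFactors hp) (Nat.dvd_of_mem_primeFactors hp)

/-- If `a` and `b` are divisible by the same prime factors of a squarefree divisor `d` of `N`,
then they are associated modulo `d`, that is, as multipliers of the `d`-torsion of `ZMod N`. -/
lemma ZMod.exists_unit_mul_of_squarefree {d : ℕ} (hdN : d ∣ N) (hd : Squarefree d) {a b : ZMod N}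
    (h : ∀ p, p.Prime → p ∣ d → (p ∣ a.val ↔ p ∣ b.val)) :
    ∃ u : (ZMod N)ˣ, ∀ x : ZMod N, addOrderOf x ∣ d → b * x = a * (u * x) := by
  have : NeZero d := ⟨hd.ne_zero⟩
  set f := ZMod.castHom hdN (ZMod d) with hf
  have key : ∀ c : ZMod N, ∃ e, e ∣ d ∧ (∃ u : (ZMod d)ˣ, f c = u * e) ∧
      ∀ p, p ∣ d → (p ∣ e ↔ p ∣ c.val) := by
    intro c
    obtain ⟨e, he, u, hu, hc⟩ := ZMod.eq_unit_mul_divisor (f c)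
    refine ⟨e, he, ⟨hu.unit, hc⟩, fun p hp => ?_⟩
    rw [← ZMod.dvd_val_unit_mul_iff hp hu, ← hc, ZMod.dvd_val_iff_castHom_eq_zero hp,
      ZMod.dvd_val_iff_castHom_eq_zero (hp.trans hdN), ← RingHom.comp_apply]
    rw [RingHom.ext_zmod ((ZMod.castHom hp (ZMod p)).comp f) (ZMod.castHom (hp.trans hdN) (ZMod p))]
  obtain ⟨e₁, he₁, ⟨u₁, hu₁⟩, h₁⟩ := key a
  obtain ⟨e₂, he₂, ⟨u₂, hu₂⟩, h₂⟩ := key b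
  have he : e₁ = e₂ := by
    apply Nat.dvd_antisymm
    · exact Nat.dvd_of_squarefree_of_forall_prime (hd.squarefree_of_dvd he₁) fun p hp hpe =>
        (h₂ p (hpe.trans he₁)).2 <| (h p hp (hpe.trans he₁)).1 <| (h₁ p (hpe.trans he₁)).1 hpe
    · exact Nat.dvd_of_squarefree_of_forall_prime (hd.squarefree_of_dvd he₂) fun p hp hpe =>
        (h₁ p (hpe.trans he₂)).2 <| (h p hp (hpe.trans he₂)).2 <| (h₂ p (hpe.trans he₂)).1 hpe
  subst he
  obtain ⟨u, hu⟩ := ZMod.unitsMap_surjective hdN (u₂ * u₁⁻¹)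
  have hfu : f u = u₂ * (u₁⁻¹ : (ZMod d)ˣ) := by
    rw [← Units.val_mul, ← hu, ZMod.unitsMap_def]; rfl
  refine ⟨u, fun x hx => ?_⟩
  have h0 : f (b - a * (u : ZMod N)) = 0 := by
    rw [map_sub, map_mul, hfu, hu₁, hu₂, sub_eq_zero]
    calc (u₂ : ZMod d) * e₁ = u₂ * e₁ * (u₁ * (u₁⁻¹ : (ZMod d)ˣ)) := by rw [Units.mul_inv, mul_one]
      _ = _ := by ring
  rw [hf, ← ZMod.dvd_val_iff_castHom_eq_zero] at h0
  obtain ⟨k, hk⟩ := h0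
  have h1 : b - a * (u : ZMod N) = (d : ZMod N) * k := by
    rw [← ZMod.natCast_zmod_val (b - a * (u : ZMod N)), hk, Nat.cast_mul]
  rw [← sub_eq_zero, ← mul_assoc, ← sub_mul, h1, mul_right_comm,
    ZMod.addOrderOf_dvd_iff_natCast_mul.1 hx, zero_mul]

end UnitsAndOrders

section CharacterSums

variable {N : ℕ} [NeZero N]

lemma ZMod.exp_pow_val_eq_stdAddChar (x : ZMod N) :
    Complex.exp (2 * Real.pi * Complex.I / N) ^ x.val = ZMod.stdAddChar x := by
  rw [ZMod.stdAddChar_apply, ZMod.toCircle_apply, ← Complex.exp_nat_mul]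
  congr 1; ring

lemma ZMod.sum_stdAddChar_unit_mul (s : Finset (ZMod N)) (u : (ZMod N)ˣ)
    (hs : ∀ x : ZMod N, (u : ZMod N) * x ∈ s ↔ x ∈ s) (a : ZMod N) :
    ∑ x ∈ s, ZMod.stdAddChar (a * ((u : ZMod N) * x)) = ∑ x ∈ s, ZMod.stdAddChar (a * x) := by
  refine Finset.sum_bijective (fun x => (u : ZMod N) * x) ?_ (fun x => (hs x).symm) fun _ _ => rfl
  exact u.mulLeft_bijective

lemma ZMod.sum_stdAddChar_eq_zero (s : Finset (ZMod N)) (t a : ZMod N)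
    (hs : ∀ x, t + x ∈ s ↔ x ∈ s) (h : a * t ≠ 0) :
    ∑ x ∈ s, ZMod.stdAddChar (a * x) = 0 := by
  have h1 : ∑ x ∈ s, ZMod.stdAddChar (a * (t + x)) = ∑ x ∈ s, ZMod.stdAddChar (a * x) :=
    Finset.sum_bijective (fun x => t + x) (AddGroup.addLeft_bijective t) (fun x => (hs x).symm)
      fun _ _ => rfl
  simp_rw [mul_add, AddChar.map_add_eq_mul, ← Finset.mul_sum] at h1
  refine (mul_left_eq_self₀.1 h1).resolve_left fun h2 => h ?_
  apply ZMod.injective_stdAddChar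
  rw [h2, AddChar.map_zero_eq_one]

end CharacterSums

section Weight

variable {N : ℕ} [NeZero N]

lemma ArithmeticFunction.sum_divisors_moebius (n : ℕ) :
    ∑ d ∈ n.divisors, moebius d = if n = 1 then 1 else 0 := by
  rw [← ArithmeticFunction.coe_mul_zeta_apply, ArithmeticFunction.moebius_mul_coe_zeta,
    ArithmeticFunction.one_apply]

lemma ZMod.sum_addOrderOf_dvd {M : Type*} [AddCommMonoid M] {n : ℕ} (hn : n ≠ 0)
    (F : ZMod N → M) :
    ∑ y with addOrderOf y ∣ n, F y = ∑ d ∈ n.divisors, ∑ y with addOrderOf y = d, F y := by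
  rw [← Finset.sum_fiberwise_of_maps_to (t := n.divisors) (g := addOrderOf)]
  · refine Finset.sum_congr rfl fun d hd => Finset.sum_congr ?_ fun _ _ => rfl
    ext y
    simp only [Finset.mem_filter, Finset.mem_univ, true_and, and_iff_right_iff_imp]
    rintro rfl
    exact Nat.dvd_of_mem_divisors hd
  · intro y hy
    exact Nat.mem_divisors.2 ⟨(Finset.mem_filter.1 hy).2, hn⟩

lemma ZMod.card_addOrderOf_eq {d : ℕ} (hd : d ∣ N) :
    (Finset.univ.filter fun y : ZMod N => addOrderOf y = d).card = d.totient := by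
  rw [IsAddCyclic.card_addOrderOf_eq_totient]
  rwa [ZMod.card]

lemma ZMod.card_addOrderOf_dvd {d : ℕ} (hd : d ∣ N) :
    (Finset.univ.filter fun y : ZMod N => addOrderOf y ∣ d).card = d := by
  have hd0 : d ≠ 0 := ne_zero_of_dvd_ne_zero (NeZero.ne N) hd
  rw [Finset.card_eq_sum_ones, ZMod.sum_addOrderOf_dvd hd0]
  conv_rhs => rw [← Nat.sum_totient d]
  refine Finset.sum_congr rfl fun e he => ?_
  rw [← Finset.card_eq_sum_ones,
    ZMod.card_addOrderOf_eq ((Nat.dvd_of_mem_divisors he).trans hd)]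

lemma ZMod.exists_addOrderOf_eq {d : ℕ} (hd : d ∣ N) : ∃ x : ZMod N, addOrderOf x = d :=
  ⟨((N / d : ℕ) : ZMod N), by
    rw [ZMod.addOrderOf_natCast_of_dvd (Nat.div_dvd_of_dvd hd), Nat.div_div_self hd (NeZero.ne N)]⟩

lemma ZMod.image_mul_right_eq (x : ZMod N) :
    Finset.image (fun r => r * x) Finset.univ
      = Finset.univ.filter fun y : ZMod N => addOrderOf y ∣ addOrderOf x := by
  ext y
  simp [ZMod.addOrderOf_dvd_addOrderOf_iff]

variable {ω : ZMod N → ℝ}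

lemma IsNormHomWeight.eq_of_addOrderOf_eq (hω : IsNormHomWeight (ZMod N) ω) {x y : ZMod N}
    (h : addOrderOf x = addOrderOf y) : ω x = ω y :=
  hω.2.1 x y (by rw [ZMod.image_mul_right_eq, ZMod.image_mul_right_eq, h])

lemma IsNormHomWeight.sum_addOrderOf_dvd (hω : IsNormHomWeight (ZMod N) ω) {d : ℕ} (hd : d ∣ N) :
    ∑ y with addOrderOf y ∣ d, ω y = d - if d = 1 then 1 else 0 := by
  obtain ⟨x, rfl⟩ := ZMod.exists_addOrderOf_eq hd
  by_cases hx : x = 0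
  · subst hx
    have : (Finset.univ.filter fun y : ZMod N => addOrderOf y ∣ addOrderOf (0 : ZMod N)) = {0} := by
      ext y; simp
    rw [this]
    simp [hω.1]
  · have := hω.2.2 x hx
    rw [ZMod.image_mul_right_eq, ZMod.card_addOrderOf_dvd hd] at this
    simp [this, hx]

lemma IsNormHomWeight.sum_addOrderOf_eq (hω : IsNormHomWeight (ZMod N) ω) {d : ℕ} (hd : d ∣ N) :
    ∑ y with addOrderOf y = d, ω y = d.totient - moebius d := by
  induction d using Nat.strong_induction_on with
  | _ d ih =>
    have hd0 : d ≠ 0 := ne_zero_of_dvd_ne_zero (NeZero.ne N) hd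
    have h1 := hω.sum_addOrderOf_dvd hd
    have h2 : ∑ e ∈ d.divisors, ((e.totient : ℝ) - moebius e) = d - if d = 1 then 1 else 0 := by
      rw [Finset.sum_sub_distrib, ← Nat.cast_sum, Nat.sum_totient, ← Int.cast_sum,
        ArithmeticFunction.sum_divisors_moebius]
      push_cast; rfl
    rw [ZMod.sum_addOrderOf_dvd hd0, ← h2, ← Nat.insert_self_properDivisors hd0,
      Finset.sum_insert Nat.self_notMem_properDivisors,
      Finset.sum_insert Nat.self_notMem_properDivisors, Finset.sum_congr rfl fun e he =>
        ih e (Nat.mem_properDivisors.1 he).2 ((Nat.mem_properDivisors.1 he).1.trans hd)] at h1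
    exact add_right_cancel h1

lemma IsNormHomWeight.apply_eq (hω : IsNormHomWeight (ZMod N) ω) (x : ZMod N) :
    ω x = 1 - moebius (addOrderOf x) / (addOrderOf x).totient := by
  have hd := ZMod.addOrderOf_dvd x
  have h := hω.sum_addOrderOf_eq hd
  rw [Finset.sum_congr rfl fun y hy => hω.eq_of_addOrderOf_eq (Finset.mem_filter.1 hy).2,
    Finset.sum_const, ZMod.card_addOrderOf_eq hd, nsmul_eq_mul] at h
  have h0 : ((addOrderOf x).totient : ℝ) ≠ 0 :=
    Nat.cast_ne_zero.2 (Nat.totient_pos.2 (addOrderOf_pos x)).ne'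
  field_simp
  linarith

end Weight

section Arithmetic

lemma Nat.totient_prod_primes {S : Finset ℕ} (hS : ∀ p ∈ S, p.Prime) :
    (∏ p ∈ S, p).totient = ∏ p ∈ S, (p - 1) := by
  have h := Nat.totient_mul_prod_primeFactors (∏ p ∈ S, p)
  rw [Nat.primeFactors_prod hS, mul_comm] at h
  exact Nat.eq_of_mul_eq_mul_left (Finset.prod_pos fun p hp => (hS p hp).pos) h

lemma ArithmeticFunction.moebius_prod_primes {S : Finset ℕ} (hS : ∀ p ∈ S, p.Prime) :
    moebius (∏ p ∈ S, p) = (-1) ^ S.card := by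
  rw [ArithmeticFunction.isMultiplicative_moebius.map_prod_of_prime S hS, Finset.prod_congr rfl
    fun p hp => ArithmeticFunction.moebius_apply_prime (hS p hp), Finset.prod_const]

lemma Nat.squarefree_prod_primes {S : Finset ℕ} (hS : ∀ p ∈ S, p.Prime) :
    Squarefree (∏ p ∈ S, p) := by
  rw [← ArithmeticFunction.moebius_ne_zero_iff_squarefree,
    ArithmeticFunction.moebius_prod_primes hS]
  exact pow_ne_zero _ (by norm_num)

lemma moebius_div_totient_eq_iff {d e : ℕ} (hd : Squarefree d) (he : e ≠ 0) :
    (moebius d : ℝ) / d.totient = moebius e / e.totient ↔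
      d.totient = e.totient ∧ moebius d = moebius e := by
  constructor
  · intro h
    have hd1 : (0 : ℝ) < d.totient := Nat.cast_pos.2 (Nat.totient_pos.2 hd.ne_zero.bot_lt)
    have he1 : (0 : ℝ) < e.totient := Nat.cast_pos.2 (Nat.totient_pos.2 he.bot_lt)
    have hμd : moebius d = 1 ∨ moebius d = -1 :=
      ArithmeticFunction.moebius_ne_zero_iff_eq_or.1
        (ArithmeticFunction.moebius_ne_zero_iff_squarefree.2 hd)
    rw [div_eq_div_iff hd1.ne' he1.ne'] at h
    rcases hμd with h1 | h1 <;> rcases ArithmeticFunction.moebius_eq_or e with h2 | h2 | h2 <;>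
      rw [h1, h2] at h ⊢ <;> push_cast at h <;>
      first
      | (exfalso; linarith)
      | exact ⟨by exact_mod_cast (by linarith : (d.totient : ℝ) = e.totient), rfl⟩
  · rintro ⟨h1, h2⟩
    rw [h1, h2]

lemma Nat.Prime.lt_of_dvd_of_totient_eq {p q d : ℕ} (hp : p.Prime) (hq : q.Prime)
    (hd : Squarefree d) (hφ : d.totient = p.totient) (hμ : moebius d = moebius p) (hdp : d ≠ p)
    (hqd : q ∣ d) : q < p := by
  obtain ⟨e, rfl⟩ := hqd
  have hqe := (Nat.squarefree_mul_iff.1 hd).1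
  have he0 : 0 < e := Nat.pos_of_ne_zero (right_ne_zero_of_mul hd.ne_zero)
  rw [Nat.totient_mul hqe, Nat.totient_prime hp, Nat.totient_prime hq] at hφ
  have hle : q - 1 ≤ p - 1 := hφ ▸ Nat.le_mul_of_pos_right _ (Nat.totient_pos.2 he0)
  have h2q := hq.two_le
  have h2p := hp.two_le
  refine lt_of_le_of_ne (by omega) ?_
  rintro rfl
  have h1 : e.totient = 1 := Nat.eq_of_mul_eq_mul_left (by omega : 0 < q - 1) (by rw [hφ, mul_one])
  rcases Nat.totient_eq_one_iff.1 h1 with rfl | rfl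
  · simp at hdp
  · rw [ArithmeticFunction.isMultiplicative_moebius.map_mul_of_coprime hqe,
      ArithmeticFunction.moebius_apply_prime hq,
      ArithmeticFunction.moebius_apply_prime Nat.prime_two] at hμ
    norm_num at hμ

end Arithmetic

section Duality

variable {N : ℕ} [NeZero N] {ζ : ℂ} {ω : ZMod N → ℝ}

lemma homRel1_iff_stdAddChar (hζ : ζ = Complex.exp (2 * Real.pi * Complex.I / N))
    {a b : ZMod N} :
    HomRel1 N ζ ω a b ↔ ∀ c : ℝ, ∑ x with ω x = c, ZMod.stdAddChar (a * x)
      = ∑ x with ω x = c, ZMod.stdAddChar (b * x) := by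
  subst hζ
  simp only [HomRel1, ZMod.exp_pow_val_eq_stdAddChar]

lemma homRel2_iff_stdAddChar (hζ : ζ = Complex.exp (2 * Real.pi * Complex.I / N))
    {a b : ZMod N} :
    HomRel2 N ζ ω a b ↔ ∀ a₀ : ZMod N, ∑ x with HomRel1 N ζ ω a₀ x, ZMod.stdAddChar (a * x)
      = ∑ x with HomRel1 N ζ ω a₀ x, ZMod.stdAddChar (b * x) := by
  simp only [HomRel2, hζ, ZMod.exp_pow_val_eq_stdAddChar]

lemma IsNormHomWeight.eq_one_iff (hω : IsNormHomWeight (ZMod N) ω) (x : ZMod N) :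
    ω x = 1 ↔ ¬ Squarefree (addOrderOf x) := by
  have h0 : ((addOrderOf x).totient : ℝ) ≠ 0 :=
    Nat.cast_ne_zero.2 (Nat.totient_pos.2 (addOrderOf_pos x)).ne'
  rw [hω.apply_eq, sub_eq_self, div_eq_zero_iff, or_iff_left h0, Int.cast_eq_zero,
    ← not_iff_not, not_not, ← ArithmeticFunction.moebius_ne_zero_iff_squarefree]

lemma HomRel1.refl (a : ZMod N) : HomRel1 N ζ ω a a := fun _ => rfl

lemma HomRel1.symm {a b : ZMod N} (h : HomRel1 N ζ ω a b) : HomRel1 N ζ ω b a :=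
  fun c => (h c).symm

lemma HomRel1.trans {a b c : ZMod N} (h : HomRel1 N ζ ω a b) (h' : HomRel1 N ζ ω b c) :
    HomRel1 N ζ ω a c :=
  fun x => (h x).trans (h' x)

lemma HomRel1.eq_zero_iff (hζ : ζ = Complex.exp (2 * Real.pi * Complex.I / N)) {a b : ZMod N}
    (h : HomRel1 N ζ ω a b) : a = 0 ↔ b = 0 := by
  rw [homRel1_iff_stdAddChar hζ] at h
  have key : ∀ a : ZMod N, ∑ c ∈ Finset.univ.image ω, ∑ x with ω x = c, ZMod.stdAddChar (a * x)
      = ((if a = 0 then Fintype.card (ZMod N) else 0 : ℕ) : ℂ) := fun a => by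
    rw [Finset.sum_fiberwise_of_maps_to fun x _ => Finset.mem_image_of_mem ω (Finset.mem_univ x),
      ← AddChar.sum_mulShift a (ZMod.isPrimitive_stdAddChar N)]
    simp only [mul_comm a]
  have hab := (key a).symm.trans <| (Finset.sum_congr rfl fun c _ => h c).trans (key b)
  have hN : Fintype.card (ZMod N) ≠ 0 := Fintype.card_ne_zero
  rw [Nat.cast_inj] at hab
  split_ifs at hab <;> simp_all

/-- If `a` and `b` are divisible by the same prime factors of a squarefree divisor `d` of `N`,
then they give the same character sum over any set of `d`-torsion elements stable under units. -/
lemma ZMod.sum_stdAddChar_congr_of_dvd {d : ℕ} (hdN : d ∣ N) (hd : Squarefree d) {a b : ZMod N}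
    (h : ∀ p, p.Prime → p ∣ d → (p ∣ a.val ↔ p ∣ b.val)) (s : Finset (ZMod N))
    (hs : ∀ x ∈ s, addOrderOf x ∣ d)
    (hs' : ∀ (u : (ZMod N)ˣ) (x : ZMod N), (u : ZMod N) * x ∈ s ↔ x ∈ s) :
    ∑ x ∈ s, ZMod.stdAddChar (a * x) = ∑ x ∈ s, ZMod.stdAddChar (b * x) := by
  obtain ⟨u, hu⟩ := ZMod.exists_unit_mul_of_squarefree hdN hd h
  rw [Finset.sum_congr rfl fun x hx => congrArg ZMod.stdAddChar (hu x (hs x hx)),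
    ZMod.sum_stdAddChar_unit_mul s u (hs' u)]

lemma IsNormHomWeight.apply_unit_mul (hω : IsNormHomWeight (ZMod N) ω) (u : (ZMod N)ˣ)
    (x : ZMod N) : ω (u * x) = ω x :=
  hω.eq_of_addOrderOf_eq (ZMod.addOrderOf_unit_mul u x)

lemma homRel1_of_dvd_iff (hζ : ζ = Complex.exp (2 * Real.pi * Complex.I / N))
    (hω : IsNormHomWeight (ZMod N) ω) {a b : ZMod N} (h0 : a = 0 ↔ b = 0)
    (h : ∀ p ∈ N.primeFactors, (p ∣ a.val ↔ p ∣ b.val)) : HomRel1 N ζ ω a b := by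
  rw [homRel1_iff_stdAddChar hζ]
  have hrad : ∏ p ∈ N.primeFactors, p ∣ N := Nat.prod_primeFactors_dvd N
  have hsq : Squarefree (∏ p ∈ N.primeFactors, p) :=
    Nat.squarefree_prod_primes fun p => Nat.prime_of_mem_primeFactors
  have hmem : ∀ p, p.Prime → p ∣ N → p ∈ N.primeFactors := fun p hp hpN =>
    Nat.mem_primeFactors.2 ⟨hp, hpN, NeZero.ne N⟩
  have key : ∀ s : Finset (ZMod N), (∀ x ∈ s, Squarefree (addOrderOf x)) →
      (∀ (u : (ZMod N)ˣ) (x : ZMod N), (u : ZMod N) * x ∈ s ↔ x ∈ s) →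
      ∑ x ∈ s, ZMod.stdAddChar (a * x) = ∑ x ∈ s, ZMod.stdAddChar (b * x) := by
    intro s hs
    refine ZMod.sum_stdAddChar_congr_of_dvd hrad hsq
      (fun p hp hpd => h p (hmem p hp (hpd.trans hrad))) s fun x hx => ?_
    refine Nat.dvd_of_squarefree_of_forall_prime (hs x hx) fun p hp hpx => ?_
    exact Finset.dvd_prod_of_mem _ (hmem p hp (hpx.trans (ZMod.addOrderOf_dvd x)))
  intro c
  by_cases hc : c = 1
  · have h1 := key (Finset.univ.filter fun x => ¬ ω x = c)
      (fun x hx => by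
        rw [Finset.mem_filter, hc, hω.eq_one_iff, not_not] at hx
        exact hx.2)
      (fun u x => by simp [hω.apply_unit_mul])
    have htot : ∑ x, ZMod.stdAddChar (a * x) = ∑ x, ZMod.stdAddChar (b * x) := by
      simp only [mul_comm a, mul_comm b, AddChar.sum_mulShift _ (ZMod.isPrimitive_stdAddChar N), h0]
    rw [← Finset.sum_filter_add_sum_filter_not _ (fun x => ω x = c),
      ← Finset.sum_filter_add_sum_filter_not Finset.univ (fun x => ω x = c)
        (fun x => ZMod.stdAddChar (b * x)), h1] at htot
    exact add_right_cancel htot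
  · refine key _ (fun x hx => ?_) fun u x => by simp [hω.apply_unit_mul]
    rw [Finset.mem_filter] at hx
    by_contra hsx
    exact hc (hx.2 ▸ (hω.eq_one_iff x).2 hsx)

lemma ZMod.sum_stdAddChar_addOrderOf_eq_prime {p : ℕ} (hp : p.Prime) (hpN : p ∣ N) {b : ZMod N}
    (hb : ¬ p ∣ b.val) : ∑ x with addOrderOf x = p, ZMod.stdAddChar (b * x) = -1 := by
  obtain ⟨t, ht⟩ := ZMod.exists_addOrderOf_eq hpN
  have hbt : b * t ≠ 0 := by
    rwa [Ne, ZMod.mul_eq_zero_iff_addOrderOf_dvd_val, ht]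
  have h := ZMod.sum_stdAddChar_eq_zero (Finset.univ.filter fun x : ZMod N => addOrderOf x ∣ p) t b
    (fun x => by simp [ZMod.addOrderOf_add_dvd_iff (dvd_of_eq ht)]) hbt
  rw [ZMod.sum_addOrderOf_dvd hp.ne_zero, hp.sum_divisors] at h
  have h1 : (Finset.univ.filter fun x : ZMod N => addOrderOf x = 1) = {0} := by
    ext x; simp
  rw [h1] at h
  simp only [Finset.sum_singleton, mul_zero, AddChar.map_zero_eq_one] at h
  linear_combination h

lemma HomRel1.dvd_of_minimal (hζ : ζ = Complex.exp (2 * Real.pi * Complex.I / N))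
    (hω : IsNormHomWeight (ZMod N) ω) {a b : ZMod N} (hab : HomRel1 N ζ ω a b) {p : ℕ}
    (hp : p ∈ N.primeFactors) (hlt : ∀ q ∈ N.primeFactors, q < p → (q ∣ a.val ↔ q ∣ b.val))
    (ha : p ∣ a.val) : p ∣ b.val := by
  by_contra hb
  obtain ⟨hpp, hpN, -⟩ := Nat.mem_primeFactors.1 hp
  obtain ⟨t, ht⟩ := ZMod.exists_addOrderOf_eq hpN
  have h := (homRel1_iff_stdAddChar hζ).1 hab (ω t)
  set S := N.primeFactors.filter (· < p) with hS
  have hSp : ∀ q ∈ S, q.Prime := fun q hq =>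
    Nat.prime_of_mem_primeFactors (Finset.mem_filter.1 hq).1
  have hSN : ∏ q ∈ S, q ∣ N :=
    (Finset.prod_dvd_prod_of_subset _ _ _ (Finset.filter_subset _ _)).trans
      (Nat.prod_primeFactors_dvd N)
  have hrest : ∑ x with ω x = ω t ∧ addOrderOf x ≠ p, ZMod.stdAddChar (a * x)
      = ∑ x with ω x = ω t ∧ addOrderOf x ≠ p, ZMod.stdAddChar (b * x) := by
    refine ZMod.sum_stdAddChar_congr_of_dvd hSN (Nat.squarefree_prod_primes hSp) ?_ _ ?_ ?_
    · intro q hq hqS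
      have : q ∈ S := by
        rw [← Nat.primeFactors_prod hSp]
        exact Nat.mem_primeFactors.2 ⟨hq, hqS, ne_zero_of_dvd_ne_zero (NeZero.ne N) hSN⟩
      exact hlt q (Finset.mem_filter.1 this).1 (Finset.mem_filter.1 this).2
    · intro x hx
      obtain ⟨-, hxt, hxp⟩ := Finset.mem_filter.1 hx
      rw [hω.apply_eq, hω.apply_eq, ht, sub_right_inj, eq_comm,
        moebius_div_totient_eq_iff hpp.squarefree (addOrderOf_pos x).ne'] at hxt
      have hxsq : Squarefree (addOrderOf x) := by
        rw [← ArithmeticFunction.moebius_ne_zero_iff_squarefree, ← hxt.2,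
          ArithmeticFunction.moebius_ne_zero_iff_squarefree]
        exact hpp.squarefree
      refine Nat.dvd_of_squarefree_of_forall_prime hxsq fun q hq hqx => ?_
      refine Finset.dvd_prod_of_mem _ (Finset.mem_filter.2 ⟨Nat.mem_primeFactors.2
        ⟨hq, hqx.trans (ZMod.addOrderOf_dvd x), NeZero.ne N⟩, ?_⟩)
      exact hpp.lt_of_dvd_of_totient_eq hq hxsq hxt.1.symm hxt.2.symm hxp hqx
    · intro u x
      simp [hω.apply_unit_mul, ZMod.addOrderOf_unit_mul]
  have hsplit : ∀ c : ZMod N, ∑ x with ω x = ω t, ZMod.stdAddChar (c * x)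
      = ∑ x with addOrderOf x = p, ZMod.stdAddChar (c * x)
        + ∑ x with ω x = ω t ∧ addOrderOf x ≠ p, ZMod.stdAddChar (c * x) := by
    intro c
    rw [← Finset.sum_filter_add_sum_filter_not _ (fun x => addOrderOf x = p),
      Finset.filter_filter, Finset.filter_filter]
    congr 2
    ext x
    simp only [Finset.mem_filter, Finset.mem_univ, true_and, and_iff_right_iff_imp]
    exact fun hx => hω.eq_of_addOrderOf_eq (hx.trans ht.symm)
  rw [hsplit, hsplit, hrest, add_left_inj, ZMod.sum_stdAddChar_addOrderOf_eq_prime hpp hpN hb,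
    Finset.sum_congr rfl fun x hx => by
      rw [ZMod.mul_eq_zero_iff_addOrderOf_dvd_val.2 ((Finset.mem_filter.1 hx).2 ▸ ha),
        AddChar.map_zero_eq_one],
    Finset.sum_const, nsmul_eq_mul, mul_one] at h
  have h' := congrArg Complex.re h
  simp only [Complex.natCast_re, Complex.neg_re, Complex.one_re] at h'
  have := Nat.cast_nonneg (α := ℝ)
    (Finset.univ.filter fun x : ZMod N => addOrderOf x = p).card
  linarith

lemma HomRel1.dvd_iff (hζ : ζ = Complex.exp (2 * Real.pi * Complex.I / N))
    (hω : IsNormHomWeight (ZMod N) ω) {a b : ZMod N} (hab : HomRel1 N ζ ω a b) {p : ℕ}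
    (hp : p ∈ N.primeFactors) : p ∣ a.val ↔ p ∣ b.val := by
  induction p using Nat.strong_induction_on with
  | _ p ih =>
    exact ⟨hab.dvd_of_minimal hζ hω hp fun q hq hqp => ih q hqp hq,
      hab.symm.dvd_of_minimal hζ hω hp fun q hq hqp => (ih q hqp hq).symm⟩

lemma homRel1_iff (hζ : ζ = Complex.exp (2 * Real.pi * Complex.I / N))
    (hω : IsNormHomWeight (ZMod N) ω) {a b : ZMod N} :
    HomRel1 N ζ ω a b ↔ (a = 0 ↔ b = 0) ∧ ∀ p ∈ N.primeFactors, (p ∣ a.val ↔ p ∣ b.val) :=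
  ⟨fun h => ⟨h.eq_zero_iff hζ, fun _ hp => h.dvd_iff hζ hω hp⟩,
    fun h => homRel1_of_dvd_iff hζ hω h.1 h.2⟩

/-- Character sums over sets that are unions of classes of `~₁` agree at `~₂`-related points. -/
lemma HomRel2.sum_eq (hζ : ζ = Complex.exp (2 * Real.pi * Complex.I / N)) {a b : ZMod N}
    (hab : HomRel2 N ζ ω a b) (s : Finset (ZMod N))
    (hs : ∀ x y, HomRel1 N ζ ω x y → (x ∈ s ↔ y ∈ s)) :
    ∑ x ∈ s, ZMod.stdAddChar (a * x) = ∑ x ∈ s, ZMod.stdAddChar (b * x) := by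
  rw [homRel2_iff_stdAddChar hζ] at hab
  let cls : ZMod N → Finset (ZMod N) := fun a₀ => Finset.univ.filter fun x => HomRel1 N ζ ω a₀ x
  have key : ∀ c : ZMod N, ∑ x ∈ s, ZMod.stdAddChar (c * x)
      = ∑ Q ∈ s.image cls, ∑ x ∈ Q, ZMod.stdAddChar (c * x) := by
    intro c
    rw [← Finset.sum_fiberwise_of_maps_to fun x hx => Finset.mem_image_of_mem cls hx]
    refine Finset.sum_congr rfl fun Q hQ => Finset.sum_congr ?_ fun _ _ => rfl
    obtain ⟨a₀, ha₀, rfl⟩ := Finset.mem_image.1 hQ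
    ext x
    simp only [Finset.mem_filter, cls, Finset.mem_univ, true_and]
    constructor
    · rintro ⟨-, hx⟩
      have : x ∈ Finset.univ.filter fun y => HomRel1 N ζ ω x y := by simp [HomRel1.refl]
      rw [hx] at this
      simpa using this
    · intro hx
      refine ⟨(hs a₀ x hx).1 ha₀, ?_⟩
      ext y
      simp only [Finset.mem_filter, Finset.mem_univ, true_and]
      exact ⟨fun h => hx.trans h, fun h => hx.symm.trans h⟩
  rw [key, key]
  refine Finset.sum_congr rfl fun Q hQ => ?_
  obtain ⟨a₀, -, rfl⟩ := Finset.mem_image.1 hQ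
  exact hab a₀

lemma HomRel2.addOrderOf_dvd (hζ : ζ = Complex.exp (2 * Real.pi * Complex.I / N))
    (hω : IsNormHomWeight (ZMod N) ω) {a b : ZMod N} (hab : HomRel2 N ζ ω a b)
    (ha : Squarefree (addOrderOf a)) : addOrderOf b ∣ addOrderOf a := by
  set d := addOrderOf a with hd
  have hdN : d ∣ N := ZMod.addOrderOf_dvd a
  have h := hab.sum_eq hζ (Finset.univ.filter fun x : ZMod N => d ∣ x.val) fun x y hxy => by
    have hp : ∀ p, p.Prime → p ∣ d → (p ∣ x.val ↔ p ∣ y.val) := fun p hp hpd =>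
      hxy.dvd_iff hζ hω (Nat.mem_primeFactors.2 ⟨hp, hpd.trans hdN, NeZero.ne N⟩)
    simp only [Finset.mem_filter, Finset.mem_univ, true_and]
    exact ⟨fun hx => Nat.dvd_of_squarefree_of_forall_prime ha fun p hpp hpd =>
        (hp p hpp hpd).1 (hpd.trans hx),
      fun hy => Nat.dvd_of_squarefree_of_forall_prime ha fun p hpp hpd =>
        (hp p hpp hpd).2 (hpd.trans hy)⟩
  rw [ZMod.addOrderOf_dvd_iff_natCast_mul, mul_comm]
  by_contra hbd
  rw [ZMod.sum_stdAddChar_eq_zero _ (d : ZMod N) b (fun x => by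
      simp only [Finset.mem_filter, Finset.mem_univ, true_and,
        ZMod.dvd_val_natCast_add_iff hdN dvd_rfl]) hbd,
    Finset.sum_congr rfl fun x hx => by
      rw [mul_comm, ZMod.mul_eq_zero_iff_addOrderOf_dvd_val.2 (Finset.mem_filter.1 hx).2,
        AddChar.map_zero_eq_one],
    Finset.sum_const, nsmul_eq_mul, mul_one, Nat.cast_eq_zero, Finset.card_eq_zero] at h
  exact Finset.notMem_empty (0 : ZMod N) (h ▸ by simp)

lemma homRel2_of_addOrderOf_eq (hζ : ζ = Complex.exp (2 * Real.pi * Complex.I / N))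
    (hω : IsNormHomWeight (ZMod N) ω) {a b : ZMod N} (hab : addOrderOf a = addOrderOf b) :
    HomRel2 N ζ ω a b := by
  obtain ⟨u, rfl⟩ := ZMod.exists_unit_mul_of_addOrderOf_eq hab
  rw [homRel2_iff_stdAddChar hζ]
  intro a₀
  rw [← ZMod.sum_stdAddChar_unit_mul _ u fun x => ?_]
  · simp only [mul_left_comm a, mul_assoc]
  · have hx : HomRel1 N ζ ω (u * x) x := by
      refine (homRel1_iff hζ hω).2 ⟨Units.mul_right_eq_zero u, fun p hp => ?_⟩
      have hpN := Nat.dvd_of_mem_primeFactors hp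
      rw [ZMod.dvd_val_iff_castHom_eq_zero hpN, ZMod.dvd_val_iff_castHom_eq_zero hpN, map_mul,
        (u.isUnit.map (ZMod.castHom hpN (ZMod p))).mul_right_eq_zero]
    simp only [Finset.mem_filter, Finset.mem_univ, true_and]
    exact ⟨fun h => h.trans hx, fun h => h.trans hx.symm⟩

lemma sum_homRel1_of_not_squarefree (hζ : ζ = Complex.exp (2 * Real.pi * Complex.I / N))
    (hω : IsNormHomWeight (ZMod N) ω) {a : ZMod N} (ha : ¬ Squarefree (addOrderOf a))
    (a₀ : ZMod N) :
    ∑ x with HomRel1 N ζ ω a₀ x, ZMod.stdAddChar (a * x)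
      = if a₀ = 0 then 1 else if ∀ p ∈ N.primeFactors, p ∣ a₀.val then -1 else 0 := by
  by_cases h0 : a₀ = 0
  · subst h0
    have : (Finset.univ.filter fun x => HomRel1 N ζ ω 0 x) = {0} := by
      ext x
      simp only [Finset.mem_filter, Finset.mem_univ, true_and, Finset.mem_singleton]
      exact ⟨fun h => (h.eq_zero_iff hζ).1 rfl, by rintro rfl; exact HomRel1.refl _⟩
    simp [this]
  set s := Finset.univ.filter fun x : ZMod N =>
    ∀ p ∈ N.primeFactors, (p ∣ a₀.val ↔ p ∣ x.val) with hs
  have hrad : ∏ p ∈ N.primeFactors, p ∣ N := Nat.prod_primeFactors_dvd N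
  have hsum : ∑ x ∈ s, ZMod.stdAddChar (a * x) = 0 := by
    refine ZMod.sum_stdAddChar_eq_zero s ((∏ p ∈ N.primeFactors, p : ℕ) : ZMod N) a
      (fun x => ?_) fun h => ha ?_
    · simp only [hs, Finset.mem_filter, Finset.mem_univ, true_and]
      refine forall₂_congr fun p hp => ?_
      rw [ZMod.dvd_val_natCast_add_iff (Nat.dvd_of_mem_primeFactors hp)
        (Finset.dvd_prod_of_mem _ hp)]
    · rw [mul_comm, ← ZMod.addOrderOf_dvd_iff_natCast_mul] at h
      exact (Nat.squarefree_prod_primes fun p => Nat.prime_of_mem_primeFactors).squarefree_of_dvd h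
  have hcls : (Finset.univ.filter fun x => HomRel1 N ζ ω a₀ x) = s.erase 0 := by
    ext x
    simp only [hs, homRel1_iff hζ hω, h0, false_iff, Finset.mem_filter, Finset.mem_univ, true_and,
      Finset.mem_erase, ne_eq]
  rw [hcls, if_neg h0]
  have hmem : (0 : ZMod N) ∈ s ↔ ∀ p ∈ N.primeFactors, p ∣ a₀.val := by simp [hs]
  split_ifs with h
  · rw [Finset.sum_erase_eq_sub (hmem.2 h), hsum, mul_zero, AddChar.map_zero_eq_one, zero_sub]
  · rw [Finset.erase_eq_of_notMem (mt hmem.1 h), hsum]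

lemma homRel2_of_not_squarefree (hζ : ζ = Complex.exp (2 * Real.pi * Complex.I / N))
    (hω : IsNormHomWeight (ZMod N) ω) {a b : ZMod N} (ha : ¬ Squarefree (addOrderOf a))
    (hb : ¬ Squarefree (addOrderOf b)) : HomRel2 N ζ ω a b := by
  rw [homRel2_iff_stdAddChar hζ]
  intro a₀
  rw [sum_homRel1_of_not_squarefree hζ hω ha, sum_homRel1_of_not_squarefree hζ hω hb]

lemma HomRel2.symm {a b : ZMod N} (h : HomRel2 N ζ ω a b) : HomRel2 N ζ ω b a :=
  fun a₀ => (h a₀).symm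

lemma homRel2_iff (hζ : ζ = Complex.exp (2 * Real.pi * Complex.I / N))
    (hω : IsNormHomWeight (ZMod N) ω) {a b : ZMod N} :
    HomRel2 N ζ ω a b ↔ addOrderOf a = addOrderOf b ∨
      ¬ Squarefree (addOrderOf a) ∧ ¬ Squarefree (addOrderOf b) := by
  refine ⟨fun h => ?_, fun h => h.elim (homRel2_of_addOrderOf_eq hζ hω)
    fun h => homRel2_of_not_squarefree hζ hω h.1 h.2⟩
  by_cases ha : Squarefree (addOrderOf a)
  · have hba := h.addOrderOf_dvd hζ hω ha
    exact .inl (Nat.dvd_antisymm (h.symm.addOrderOf_dvd hζ hω (ha.squarefree_of_dvd hba)) hba)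
  · refine .inr ⟨ha, fun hb => ha ?_⟩
    exact hb.squarefree_of_dvd (h.symm.addOrderOf_dvd hζ hω hb)

lemma IsNormHomWeight.apply_eq_apply_iff (hω : IsNormHomWeight (ZMod N) ω) {a b : ZMod N}
    (ha : Squarefree (addOrderOf a)) :
    ω a = ω b ↔ (addOrderOf a).totient = (addOrderOf b).totient ∧
      moebius (addOrderOf a) = moebius (addOrderOf b) := by
  rw [hω.apply_eq, hω.apply_eq, sub_right_inj,
    moebius_div_totient_eq_iff ha (addOrderOf_pos b).ne']

end Duality

lemma neg_one_pow_eq_neg_one_pow_iff_mod_two {m n : ℕ} :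
    (-1 : ℤ) ^ m = (-1) ^ n ↔ m % 2 = n % 2 := by
  rcases Nat.mod_two_eq_zero_or_one m with hm | hm <;>
    rcases Nat.mod_two_eq_zero_or_one n with hn | hn <;>
    rw [neg_one_pow_eq_pow_mod_two m, neg_one_pow_eq_pow_mod_two n, hm, hn] <;> norm_num

/-- Separation in terms of squarefree divisors instead of sets of primes. -/
lemma separatingNat_iff {N : ℕ} (hN : N ≠ 0) :
    SeparatingNat N ↔ ∀ d e : ℕ, d ∣ N → e ∣ N → Squarefree d → Squarefree e →
      d.totient = e.totient → moebius d = moebius e → d = e := by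
  have hprime : ∀ {S : Finset ℕ}, S ⊆ N.primeFactors → ∀ p ∈ S, p.Prime := fun hS p hp =>
    Nat.prime_of_mem_primeFactors (hS hp)
  constructor
  · intro h d e hd he hd' he' hφ hμ
    have hd₁ := Nat.prod_primeFactors_of_squarefree hd'
    have he₁ := Nat.prod_primeFactors_of_squarefree he'
    by_contra hne
    have hS := Nat.primeFactors_mono hd hN
    have hT := Nat.primeFactors_mono he hN
    rw [← hd₁, ← he₁, Nat.totient_prod_primes (hprime hS), Nat.totient_prod_primes (hprime hT)] at hφ
    rw [← hd₁, ← he₁, ArithmeticFunction.moebius_prod_primes (hprime hS),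
      ArithmeticFunction.moebius_prod_primes (hprime hT),
      neg_one_pow_eq_neg_one_pow_iff_mod_two] at hμ
    exact (h _ _ hS hT fun hST => hne (by rw [← hd₁, ← he₁, hST])).elim (· hφ) (· hμ)
  · intro h S T hS hT hne
    by_contra! hcon
    have hdvd : ∀ {S : Finset ℕ}, S ⊆ N.primeFactors → ∏ p ∈ S, p ∣ N := fun hS =>
      (Finset.prod_dvd_prod_of_subset _ _ _ hS).trans (Nat.prod_primeFactors_dvd N)
    refine hne ?_
    rw [← Nat.primeFactors_prod (hprime hS), ← Nat.primeFactors_prod (hprime hT),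
      h _ _ (hdvd hS) (hdvd hT) (Nat.squarefree_prod_primes (hprime hS))
        (Nat.squarefree_prod_primes (hprime hT))]
    · rw [Nat.totient_prod_primes (hprime hS), Nat.totient_prod_primes (hprime hT), hcon.1]
    · rw [ArithmeticFunction.moebius_prod_primes (hprime hS),
        ArithmeticFunction.moebius_prod_primes (hprime hT),
        neg_one_pow_eq_neg_one_pow_iff_mod_two, hcon.2]

/-- For `N ≥ 2`, `ζ = exp(2πi/N)` and `ω` the normalized homogeneous weight
on `ℤ_N`, the bidual relation `~₂` coincides with the relation `ω a = ω b` (i.e. the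
homogeneous weight partition of `ℤ_N` is reflexive) iff `N` is separating. -/
theorem homWeight_reflexive_iff_separating (N : ℕ) (hN : 2 ≤ N) [NeZero N]
    (ζ : ℂ) (hζ : ζ = Complex.exp (2 * Real.pi * Complex.I / N))
    (ω : ZMod N → ℝ) (hω : IsNormHomWeight (ZMod N) ω) :
    (∀ a b : ZMod N, HomRel2 N ζ ω a b ↔ ω a = ω b) ↔ SeparatingNat N := by
  have hN0 : N ≠ 0 := NeZero.ne N
  simp only [homRel2_iff hζ hω]
  rw [separatingNat_iff hN0]
  constructor
  · intro h d e hd he hd' he' hφ hμ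
    obtain ⟨a, rfl⟩ := ZMod.exists_addOrderOf_eq hd
    obtain ⟨b, rfl⟩ := ZMod.exists_addOrderOf_eq he
    exact ((h a b).2 ((hω.apply_eq_apply_iff hd').2 ⟨hφ, hμ⟩)).resolve_right fun h' => h'.1 hd'
  · refine fun h a b => ⟨?_, fun hab => ?_⟩
    · rintro (hab | ⟨ha, hb⟩)
      · exact hω.eq_of_addOrderOf_eq hab
      · rw [(hω.eq_one_iff a).2 ha, (hω.eq_one_iff b).2 hb]
    · by_cases ha : Squarefree (addOrderOf a)
      · have hb : Squarefree (addOrderOf b) := by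
          rwa [← not_not (a := Squarefree (addOrderOf b)), ← hω.eq_one_iff, ← hab, hω.eq_one_iff,
            not_not]
        obtain ⟨hφ, hμ⟩ := (hω.apply_eq_apply_iff ha).1 hab
        exact .inl (h _ _ (ZMod.addOrderOf_dvd a) (ZMod.addOrderOf_dvd b) ha hb hφ hμ)
      · exact .inr ⟨ha, by rwa [← hω.eq_one_iff, ← hab, hω.eq_one_iff]⟩
end

section
/- Let N ≥ 1 be an integer and let ζ, ζ' ∈ ℂ be two primitive N-th roots of unity. For a, x ∈ ℤ_N = ℤ/Nℤ write ζ^{a·x} for ζ raised to any integer representative of a·x (well-defined since ζ^N = 1). Then for every subset P ⊆ ℤ_N and all a, b ∈ ℤ_N: Σ_{x ∈ P} ζ^{a·x} = Σ_{x ∈ P} ζ^{b·x} if and only if Σ_{x ∈ P} ζ'^{a·x} = Σ_{x ∈ P} ζ'^{b·x}. (In particular, on ℤ_N the dual of any partition does not depend on the choice of the generating character.) -/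
/-- Two primitive `n`-th roots of unity are roots of the same rational polynomials. -/
theorem IsPrimitiveRoot.aeval_eq_zero_iff {K : Type*} [Field K] [CharZero K] {n : ℕ}
    (hn : 0 < n) {μ ν : K} (hμ : IsPrimitiveRoot μ n) (hν : IsPrimitiveRoot ν n)
    (p : Polynomial ℚ) : Polynomial.aeval μ p = 0 ↔ Polynomial.aeval ν p = 0 := by
  rw [← minpoly.dvd_iff, ← minpoly.dvd_iff, ← Polynomial.cyclotomic_eq_minpoly_rat hμ hn,
    ← Polynomial.cyclotomic_eq_minpoly_rat hν hn]

/-- Let `ζ, ζ'` be two primitive `N`-th roots of unity in `ℂ`.  For every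
subset `P ⊆ ℤ_N` and all `a, b ∈ ℤ_N`, the sums `Σ_{x ∈ P} ζ^{a·x}` and
`Σ_{x ∈ P} ζ^{b·x}` agree iff the corresponding sums for `ζ'` agree.  (The dual of any
partition of `ℤ_N` does not depend on the choice of the generating character.) -/
theorem char_sum_eq_indep_of_primitive_root (N : ℕ) (hN : 1 ≤ N) [NeZero N]
    (ζ ζ' : ℂ) (hζ : IsPrimitiveRoot ζ N) (hζ' : IsPrimitiveRoot ζ' N)
    (P : Finset (ZMod N)) (a b : ZMod N) :
    (∑ x ∈ P, ζ ^ (a * x).val = ∑ x ∈ P, ζ ^ (b * x).val)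
      ↔ (∑ x ∈ P, ζ' ^ (a * x).val = ∑ x ∈ P, ζ' ^ (b * x).val) := by
  have h := hζ.aeval_eq_zero_iff hN hζ'
    (∑ x ∈ P, Polynomial.X ^ (a * x).val - ∑ x ∈ P, Polynomial.X ^ (b * x).val)
  simpa only [map_sub, map_sum, map_pow, Polynomial.aeval_X, sub_eq_zero] using h
end

section
/- Let q_1, …, q_t be distinct prime powers with t ≤ 3. Then the list [(q_1,1), …, (q_t,1)] is separating; that is, for all m, ℓ ∈ {0,1}^t with m ≠ ℓ, either ∏_{i=1}^t (q_i−1)^{m_i} ≠ ∏_{i=1}^t (q_i−1)^{ℓ_i} or Σ_{i=1}^t m_i ≢ Σ_{i=1}^t ℓ_i (mod 2). Equivalently, any non-separating list of distinct prime powers, each with multiplicity 1, has length at least 4. -/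
/-- The list `[(q 1, n 1), …, (q t, n t)]` is separating: for all tuples
`m ≠ ℓ` in `{0,…,n 1} × ⋯ × {0,…,n t}`, either `∏ (q i − 1)^{m i} ≠ ∏ (q i − 1)^{ℓ i}` or
`Σ m i ≢ Σ ℓ i (mod 2)`. -/
def SeparatingList {t : ℕ} (q n : Fin t → ℕ) : Prop :=
  ∀ m ℓ : Fin t → ℕ, (∀ i, m i ≤ n i) → (∀ i, ℓ i ≤ n i) → m ≠ ℓ →
    (∏ i, (q i - 1) ^ m i ≠ ∏ i, (q i - 1) ^ ℓ i) ∨ (∑ i, m i) % 2 ≠ (∑ i, ℓ i) % 2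

theorem exponents_eq_of_prod_eq {a b c : ℕ} (ha : 0 < a) (hb : 0 < b) (hc : 0 < c)
    (hab : a ≠ b) (hac : a ≠ c) (hbc : b ≠ c) {x y z u v w : ℕ}
    (hx : x ≤ 1) (hy : y ≤ 1) (hz : z ≤ 1) (hu : u ≤ 1) (hv : v ≤ 1) (hw : w ≤ 1)
    (hprod : a ^ x * b ^ y * c ^ z = a ^ u * b ^ v * c ^ w)
    (hsum : (x + y + z) % 2 = (u + v + w) % 2) : x = u ∧ y = v ∧ z = w := by
  have mul_ne_one {r s : ℕ} (hrs : r ≠ s) : r * s ≠ 1 := fun h =>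
    hrs ((Nat.eq_one_of_mul_eq_one_right h).trans (Nat.eq_one_of_mul_eq_one_left h).symm)
  have kab := mul_ne_one hab
  have kac := mul_ne_one hac
  have kbc := mul_ne_one hbc
  have dab : a * c ≠ b * c := fun h => hab (Nat.eq_of_mul_eq_mul_right hc h)
  have dac : a * b ≠ b * c := fun h => hac (Nat.eq_of_mul_eq_mul_left hb (by linarith))
  have dbc : a * b ≠ a * c := fun h => hbc (Nat.eq_of_mul_eq_mul_left ha h)
  have ta : a * b * c ≠ a := fun h => kbc (Nat.eq_of_mul_eq_mul_left ha (by linarith))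
  have tb : a * b * c ≠ b := fun h => kac (Nat.eq_of_mul_eq_mul_left hb (by linarith))
  have tc : a * b * c ≠ c := fun h => kab (Nat.eq_of_mul_eq_mul_left hc (by linarith))
  clear mul_ne_one
  interval_cases x <;> interval_cases y <;> interval_cases z <;>
    interval_cases u <;> interval_cases v <;> interval_cases w <;>
    simp only [pow_zero, pow_one, one_mul, mul_one] at hprod hsum <;> omega

/-- Any list of at most three distinct prime powers, each with multiplicity
one, is separating; equivalently, any non-separating list of distinct prime powers with
multiplicity one has length at least `4`. -/
theorem separating_of_length_le_three {t : ℕ} (ht : t ≤ 3)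
    (q : Fin t → ℕ) (hqpp : ∀ i, IsPrimePow (q i)) (hqdist : Function.Injective q) :
    SeparatingList q (fun _ => 1) := by
  intro m ℓ hm hℓ hne
  by_contra! h
  obtain ⟨hprod, hsum⟩ := h
  have hpos : ∀ i, 0 < q i - 1 := fun i => Nat.sub_pos_of_lt (hqpp i).one_lt
  have hinj : ∀ i j, i ≠ j → q i - 1 ≠ q j - 1 := fun i j hij h =>
    hij (hqdist (by have := hpos i; have := hpos j; omega))
  dsimp only at hm hℓ
  apply hne
  interval_cases t
  · exact Subsingleton.elim m ℓ
  · simp only [Fin.sum_univ_one] at hsum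
    have hm0 := hm 0
    have hℓ0 := hℓ 0
    funext i
    rw [Subsingleton.elim i 0]
    omega
  · simp only [Fin.sum_univ_two, Fin.prod_univ_two] at hsum hprod
    have p0 := hpos 0
    have p1 := hpos 1
    obtain ⟨h0, h1, -⟩ := exponents_eq_of_prod_eq (c := (q 0 - 1) + (q 1 - 1)) (z := 0) (w := 0)
      p0 p1 (by omega) (hinj 0 1 (by decide)) (by omega) (by omega)
      (hm 0) (hm 1) zero_le_one (hℓ 0) (hℓ 1) zero_le_one (by simpa using hprod) hsum
    funext i
    fin_cases i
    exacts [h0, h1]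
  · simp only [Fin.sum_univ_three, Fin.prod_univ_three] at hsum hprod
    obtain ⟨h0, h1, h2⟩ := exponents_eq_of_prod_eq (hpos 0) (hpos 1) (hpos 2)
      (hinj 0 1 (by decide)) (hinj 0 2 (by decide)) (hinj 1 2 (by decide))
      (hm 0) (hm 1) (hm 2) (hℓ 0) (hℓ 1) (hℓ 2) hprod hsum
    funext i
    fin_cases i
    exacts [h0, h1, h2]
end
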